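/- For every integer k ≥ 6, every prime power q with q ≥ k−2, and every integer s with 1 ≤ s ≤ q−1, there exists a [3q^{k−1} − 2q^{k−2} + 1 + (k−5)·θ_{k−1} − s(q+1), k, (k−2)q^{k−1} − 5q^{k−2} + 2q^{k−3} − sq]_q linear code, where θ_{k−1} = (q^k − 1)/(q − 1). -/

import Mathlib

/-- `C` is an `[n, k, d]_q` linear code over `F`: a `k`-dimensional `F`-linear subspace of
`F^n` such that the minimum Hamming weight of a nonzero codeword equals `d`. -/
def IsLinearCodeWith (F : Type) [Field F] [DecidableEq F] (n k d : ℕ)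
    (C : Submodule F (Fin n → F)) : Prop :=
  Module.finrank F C = k ∧
  (∀ c ∈ C, c ≠ 0 → d ≤ hammingNorm c) ∧
  (∃ c ∈ C, c ≠ 0 ∧ hammingNorm c = d)

set_option linter.all false
open Polynomial Finset
open scoped LinearAlgebra.Projectivization

section geom
variable {F : Type} [Field F] [Fintype F] [DecidableEq F]
variable {V : Type} [AddCommGroup V] [Module F V] [Fintype V] [DecidableEq V]

theorem proj_sum [Fintype (ℙ F V)] (g : V → ℕ) (g0 : g 0 = 0)
    (hg : ∀ (a : Fˣ) v, g (a • v) = g v) :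
    ∑ v, g v = (Fintype.card F - 1) * ∑ P : ℙ F V, g P.rep := by
  classical
  have h1 : ∑ v, g v = ∑ v ∈ univ.filter (fun v : V => v ≠ 0), g v := by
    symm
    apply Finset.sum_subset (Finset.subset_univ _)
    intro x _ hx
    have : x = 0 := by simpa using hx
    rw [this, g0]
  have h2 : ∑ x : ℙ F V × Fˣ, g (x.2 • x.1.rep) =
      ∑ v ∈ univ.filter (fun v : V => v ≠ 0), g v := by
    apply Finset.sum_bij (fun x _ => x.2 • x.1.rep)
    · intro x _
      simpa [smul_eq_zero_iff_eq] using x.1.rep_nonzero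
    · rintro ⟨P, a⟩ _ ⟨Q, b⟩ _ h
      simp only at h
      have hPQ : P = Q := by
        rw [← P.mk_rep, ← Q.mk_rep, Projectivization.mk_eq_mk_iff]
        refine ⟨a⁻¹ * b, ?_⟩
        rw [mul_smul, ← h, inv_smul_smul]
      subst hPQ
      have : (a : F) = b := by
        have h' : (a : F) • P.rep = (b : F) • P.rep := h
        exact smul_left_injective F P.rep_nonzero h'
      rw [Units.ext this]
    · intro v hv
      have hv : v ≠ 0 := by simpa using hv
      obtain ⟨a, ha⟩ := Projectivization.exists_smul_eq_mk_rep F v hv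
      refine ⟨(Projectivization.mk F v hv, a⁻¹), mem_univ _, ?_⟩
      simp only
      rw [← ha, inv_smul_smul]
    · intros; rfl
  rw [h1, ← h2, Fintype.sum_prod_type]
  simp [hg, Fintype.card_units, Finset.mul_sum]

theorem count_sum [Fintype (ℙ F V)] {ι : Type} [Fintype ι] (U : ι → Submodule F V) (σ : ℕ)
    (m : V → ℕ) (hm : ∀ v, v ≠ 0 → m v + ∑ j, (by classical exact if v ∈ U j then 1 else 0) = σ)
    (Q : V → Prop) (DQ : DecidablePred Q) (Q0 : ¬ Q 0) (hQ : ∀ (a : Fˣ) v, Q (a • v) ↔ Q v) :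
    (Fintype.card F - 1) * (∑ P : ℙ F V, if Q P.rep then m P.rep else 0) +
      ∑ j, Nat.card {v : V // v ∈ U j ∧ Q v} = σ * Nat.card {v : V // Q v} := by
  classical
  have hms : ∀ (a : Fˣ) v, v ≠ 0 → m (a • v) = m v := by
    intro a v hv
    have h1 := hm v hv
    have h2 := hm (a • v) (by simpa [smul_eq_zero_iff_eq] using hv)
    have h3 : ∀ j, a • v ∈ U j ↔ v ∈ U j := fun j => (U j).smul_mem_iff' a
    simp only [h3] at h2
    omega
  rw [← proj_sum (fun v => if Q v then m v else 0) (by simp [Q0])]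
  · have : ∀ j, Nat.card {v : V // v ∈ U j ∧ Q v} =
        ∑ v : V, if Q v then (if v ∈ U j then 1 else 0) else 0 := by
      intro j
      rw [Nat.card_eq_fintype_card, Fintype.card_subtype, Finset.card_filter]
      apply Finset.sum_congr rfl
      intro v _
      by_cases h1 : Q v <;> by_cases h2 : v ∈ U j <;> simp [h1, h2]
    simp only [this]
    rw [Finset.sum_comm, ← Finset.sum_add_distrib, Nat.card_eq_fintype_card, Fintype.card_subtype,
      Finset.card_filter, Finset.mul_sum]
    apply Finset.sum_congr rfl
    intro v _
    by_cases h : Q v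
    · have : v ≠ 0 := fun h0 => Q0 (h0 ▸ h)
      simpa [h] using hm v this
    · simp [h]
  · intro a v
    simp only [hQ]
    by_cases h : Q v
    · have : v ≠ 0 := fun h0 => Q0 (h0 ▸ h)
      simp [h, hms a v this]
    · simp [h]

theorem card_nz (U : Submodule F V) :
    Nat.card {v : V // v ∈ U ∧ v ≠ 0} = Fintype.card F ^ Module.finrank F U - 1 := by
  classical
  have h : Fintype.card U = Fintype.card F ^ Module.finrank F U := Module.card_eq_pow_finrank
  have e : {v : V // v ∈ U ∧ v ≠ 0} ≃ {u : U // u ≠ 0} :=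
    { toFun := fun v => ⟨⟨v.1, v.2.1⟩, fun h => v.2.2 (by simpa using h)⟩
      invFun := fun u => ⟨u.1.1, u.1.2, fun h => u.2 (by simpa using h)⟩
      left_inv := fun _ => rfl
      right_inv := fun _ => rfl }
  rw [Nat.card_congr e, Nat.card_eq_fintype_card, Fintype.card_subtype_compl, h]
  simp

theorem card_phi (U : Submodule F V) (φ : Module.Dual F V) (h : ∃ u ∈ U, φ u ≠ 0) :
    Nat.card {v : V // v ∈ U ∧ φ v ≠ 0} =
      Fintype.card F ^ Module.finrank F U - Fintype.card F ^ (Module.finrank F U - 1) := by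
  classical
  obtain ⟨u, hu, hne⟩ := h
  set ψ : Module.Dual F U := φ.comp U.subtype with hψ
  have hψ0 : ψ ≠ 0 := by
    intro h
    apply hne
    have := LinearMap.congr_fun h ⟨u, hu⟩
    simpa [hψ] using this
  have hk := Module.Dual.finrank_ker_add_one_of_ne_zero hψ0
  have h1 : Fintype.card U = Fintype.card F ^ Module.finrank F U := Module.card_eq_pow_finrank
  have h2 : Fintype.card (LinearMap.ker ψ) = Fintype.card F ^ Module.finrank F (LinearMap.ker ψ) :=
    Module.card_eq_pow_finrank
  have e : {v : V // v ∈ U ∧ φ v ≠ 0} ≃ {u : U // ¬ u ∈ LinearMap.ker ψ} :=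
    { toFun := fun v => ⟨⟨v.1, v.2.1⟩, fun h => v.2.2 (by simpa [hψ] using h)⟩
      invFun := fun u => ⟨u.1.1, u.1.2, fun h => u.2 (by simpa [hψ] using h)⟩
      left_inv := fun _ => rfl
      right_inv := fun _ => rfl }
  rw [Nat.card_congr e, Nat.card_eq_fintype_card, Fintype.card_subtype_compl, h1]
  have : Module.finrank F U - 1 = Module.finrank F (LinearMap.ker ψ) := by omega
  rw [this, ← h2]

theorem code_exists {ι : Type} [Fintype ι] (U : ι → Submodule F V) (σ n k d : ℕ)
    (hk : Module.finrank F V = k)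
    (hσ : ∀ v : V, v ≠ 0 → ∑ j, (by classical exact if v ∈ U j then 1 else 0) ≤ σ)
    (hn : (Fintype.card F - 1) * n + ∑ j, (Fintype.card F ^ Module.finrank F (U j) - 1) =
      σ * (Fintype.card F ^ k - 1))
    (hd : (Fintype.card F - 1) * d + ∑ j, (Fintype.card F ^ Module.finrank F (U j) -
      Fintype.card F ^ (Module.finrank F (U j) - 1)) =
      σ * (Fintype.card F ^ k - Fintype.card F ^ (k - 1)))
    (hdpos : 0 < d) (φ₀ : Module.Dual F V) (hφ₀ : ∀ j, ∃ u ∈ U j, φ₀ u ≠ 0) (hφ0 : φ₀ ≠ 0) :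
    ∃ C : Submodule F (Fin n → F), IsLinearCodeWith F n k d C := by
  classical
  haveI : Fintype (ℙ F V) := Fintype.ofFinite _
  have hq1 : 0 < Fintype.card F - 1 := by
    have := Fintype.one_lt_card (α := F); omega
  set m : V → ℕ := fun v => σ - ∑ j, (if v ∈ U j then 1 else 0) with hmdef
  have hm : ∀ v, v ≠ 0 → m v + ∑ j, (by classical exact if v ∈ U j then 1 else 0) = σ := by
    intro v hv
    have := hσ v hv
    simp only [hmdef]
    convert Nat.sub_add_cancel this
  have hnn : ∑ P : ℙ F V, m P.rep = n := by
    have := count_sum U σ m hm (fun v => v ≠ 0) inferInstance (by simp) (by intro a v; simp [smul_eq_zero_iff_eq])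
    have hV := card_nz (⊤ : Submodule F V)
    simp only [Submodule.mem_top, true_and, finrank_top, hk] at hV
    rw [hV] at this
    simp only [card_nz, Projectivization.rep_nonzero, ne_eq, not_false_eq_true, if_true] at this
    exact Nat.eq_of_mul_eq_mul_left hq1 (by omega)
  set wt : Module.Dual F V → ℕ := fun φ => ∑ P : ℙ F V, if φ P.rep ≠ 0 then m P.rep else 0
    with hwt
  have hw : ∀ φ : Module.Dual F V, φ ≠ 0 → (Fintype.card F - 1) * wt φ +
      ∑ j, Nat.card {v : V // v ∈ U j ∧ φ v ≠ 0} =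
      σ * (Fintype.card F ^ k - Fintype.card F ^ (k - 1)) := by
    intro φ hφ
    have := count_sum U σ m hm (fun v => φ v ≠ 0) inferInstance (by simp)
      (by intro a v; rw [Units.smul_def, map_smul]; simp)
    have hex : ∃ u ∈ (⊤ : Submodule F V), φ u ≠ 0 := by
      by_contra hcon
      push Not at hcon
      exact hφ (LinearMap.ext fun v => by simpa using hcon v trivial)
    have hV := card_phi (⊤ : Submodule F V) φ hex
    simp only [Submodule.mem_top, true_and, finrank_top, hk] at hV
    rw [hV] at this
    exact this
  have hwge : ∀ φ : Module.Dual F V, φ ≠ 0 → d ≤ wt φ := by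
    intro φ hφ
    have h1 := hw φ hφ
    have h2 : ∑ j, Nat.card {v : V // v ∈ U j ∧ φ v ≠ 0} ≤
      ∑ j, (Fintype.card F ^ Module.finrank F (U j) -
      Fintype.card F ^ (Module.finrank F (U j) - 1)) := by
      apply Finset.sum_le_sum
      intro j _
      by_cases h : ∃ u ∈ U j, φ u ≠ 0
      · exact (card_phi (U j) φ h).le
      · have : IsEmpty {v : V // v ∈ U j ∧ φ v ≠ 0} := ⟨fun v => h ⟨v.1, v.2.1, v.2.2⟩⟩
        simp
    exact Nat.le_of_mul_le_mul_left (by omega) hq1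
  have hweq : wt φ₀ = d := by
    have h1 := hw φ₀ hφ0
    simp only [fun j => card_phi (U j) φ₀ (hφ₀ j)] at h1
    exact Nat.eq_of_mul_eq_mul_left hq1 (by omega)
  have hcard : Fintype.card (Σ P : ℙ F V, Fin (m P.rep)) = n := by
    simp [hnn]
  let e : (Σ P : ℙ F V, Fin (m P.rep)) ≃ Fin n := Fintype.equivFinOfCardEq hcard
  let T : Module.Dual F V →ₗ[F] (Fin n → F) :=
    LinearMap.pi fun i => Module.Dual.eval F V (e.symm i).1.rep
  have hT : ∀ φ, hammingNorm (T φ) = wt φ := by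
    intro φ
    have : hammingNorm (T φ) = ∑ i : Fin n, if φ (e.symm i).1.rep ≠ 0 then 1 else 0 := by
      rw [hammingNorm, Finset.card_filter]
      rfl
    rw [this, e.symm.sum_comp (fun x => if φ x.1.rep ≠ 0 then 1 else 0),
      Fintype.sum_sigma]
    simp only [hwt]
    apply Finset.sum_congr rfl
    intro P _
    by_cases h : φ P.rep = 0 <;> simp [h]
  have hinj : Function.Injective T := by
    rw [← LinearMap.ker_eq_bot, LinearMap.ker_eq_bot']
    intro φ hφ
    by_contra hne
    have h1 := hwge φ hne
    rw [← hT, hφ, hammingNorm_zero] at h1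
    omega
  refine ⟨LinearMap.range T, ?_, ?_, ?_⟩
  · rw [LinearMap.finrank_range_of_inj hinj, Subspace.dual_finrank_eq, hk]
  · rintro _ ⟨φ, rfl⟩ hne
    rw [hT]
    exact hwge φ (fun h => hne (by simp [h]))
  · exact ⟨T φ₀, ⟨φ₀, rfl⟩, fun h => hφ0 (hinj (by simp [h])), by rw [hT, hweq]⟩

end geom

section poly
open Polynomial Finset
variable {F : Type} [Field F] [Fintype F] [DecidableEq F]

theorem exists_noroot : ∃ v : F, ∀ x : F, x ^ 2 + x + v ≠ 0 := by
  by_contra hcon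
  push Not at hcon
  have hs : Function.Surjective (fun x : F => x ^ 2 + x) := by
    intro y
    obtain ⟨x, hx⟩ := hcon (-y)
    exact ⟨x, by simp only; linear_combination hx⟩
  have hi := Finite.injective_iff_surjective.mpr hs
  have : (0 : F) = -1 := hi (by simp)
  exact one_ne_zero (α := F) (by linear_combination this)

noncomputable def pG (v : F) : F ⊕ Fˣ → F[X]
  | Sum.inl a => X - C a
  | Sum.inr b => X ^ 2 + C (b : F) * X + C (v * (b : F) ^ 2)

def pD : F ⊕ Fˣ → ℕ
  | Sum.inl _ => 1
  | Sum.inr _ => 2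

theorem pG_deg (v : F) (i) : (pG v i).natDegree = pD i := by
  rcases i with a | b
  · simp [pG, pD]
  · simp only [pG, pD]; compute_degree!

theorem pG_monic (v : F) (i) : (pG v i).Monic := by
  rcases i with a | b
  · simp only [pG]; exact monic_X_sub_C a
  · simp only [pG]; monicity!

theorem pG_irr (v : F) (hv : ∀ x : F, x ^ 2 + x + v ≠ 0) (i) : Irreducible (pG v i) := by
  rcases i with a | b
  · exact irreducible_X_sub_C a
  · have hd := pG_deg v (Sum.inr b)
    apply irreducible_of_degree_le_three_of_not_isRoot
    · rw [hd]; simp [pD]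
    · intro x hx
      have hb : (b : F) ≠ 0 := b.ne_zero
      simp only [pG, IsRoot, eval_add, eval_mul, eval_pow, eval_X, eval_C] at hx
      apply hv (x / b)
      field_simp
      linear_combination hx

theorem pG_inj (v : F) : Function.Injective (pG v) := by
  intro i j h
  have hd : pD i = pD j := by rw [← pG_deg v i, ← pG_deg v j, h]
  rcases i with a | a <;> rcases j with b | b
  · simp only [pG] at h
    have := congrArg (fun p => p.coeff 0) h
    simp at this
    rw [this]
  · simp [pD] at hd
  · simp [pD] at hd
  · simp only [pG] at h
    have := congrArg (fun p => p.coeff 1) h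
    simp only [coeff_add, coeff_X_pow, coeff_C_mul, coeff_X_one, coeff_C] at this
    have h2 : (a : F) = b := by simpa using this
    rw [Units.ext h2]

theorem deg_bound (v : F) (hv : ∀ x : F, x ^ 2 + x + v ≠ 0) (S : Finset (F ⊕ Fˣ)) (f : F[X])
    (hf : f ≠ 0) (hS : ∀ i ∈ S, pG v i ∣ f) : ∑ i ∈ S, pD i ≤ f.natDegree := by
  have h1 : ∏ i ∈ S, pG v i ∣ f := by
    apply Finset.prod_dvd_of_coprime _ hS
    intro i _ j _ hij
    change IsCoprime _ _
    rw [(pG_irr v hv i).coprime_iff_not_dvd]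
    intro hd
    apply hij
    apply pG_inj v
    exact eq_of_monic_of_associated (pG_monic v i) (pG_monic v j)
      ((pG_irr v hv i).associated_of_dvd (pG_irr v hv j) hd)
  have h2 := natDegree_le_of_dvd h1 hf
  rw [natDegree_prod_of_monic _ _ (fun i _ => pG_monic v i)] at h2
  simpa [pG_deg] using h2

/-- multiples `g * w` with `deg w < m`, inside polynomials of degree `< k`. -/
noncomputable def flat (k : ℕ) (g : F[X]) (m : ℕ) : Submodule F (degreeLT F k) :=
  ((degreeLT F m).map (LinearMap.mulLeft F g)).comap (degreeLT F k).subtype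

theorem mem_flat {k : ℕ} {g : F[X]} {m : ℕ} {f : degreeLT F k} :
    f ∈ flat k g m ↔ ∃ w : F[X], w.degree < m ∧ g * w = f := by
  simp [flat, mem_degreeLT]

theorem finrank_degLT (m : ℕ) : Module.finrank F (degreeLT F m) = m := by
  rw [LinearEquiv.finrank_eq (degreeLTEquiv F m)]; simp

theorem finrank_flat (k : ℕ) (g : F[X]) (m : ℕ) (hg : g.Monic) (h : g.natDegree + m ≤ k) :
    Module.finrank F (flat k g m) = m := by
  have hle : (degreeLT F m).map (LinearMap.mulLeft F g) ≤ degreeLT F k := by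
    rintro _ ⟨w, hw, rfl⟩
    have hw : w.degree < m := mem_degreeLT.1 hw
    rw [mem_degreeLT]
    simp only [LinearMap.mulLeft_apply]
    by_cases h0 : w = 0
    · simp [h0, bot_lt_iff_ne_bot]
    · have := (natDegree_lt_iff_degree_lt h0).2 hw
      rw [← natDegree_lt_iff_degree_lt (mul_ne_zero hg.ne_zero h0),
        natDegree_mul hg.ne_zero h0]
      omega
  rw [flat, LinearEquiv.finrank_eq (Submodule.comapSubtypeEquivOfLe hle),
    ← (Submodule.equivMapOfInjective (LinearMap.mulLeft F g)
      (fun x y hxy => mul_left_cancel₀ hg.ne_zero hxy) (degreeLT F m)).finrank_eq]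
  exact finrank_degLT m


theorem flat_wit (k : ℕ) (hk : 4 ≤ k) (v : F) (i) (m : ℕ) (hm : 4 ≤ pD i + m) :
    ∃ u ∈ flat k (pG v i) m, (u : F[X]).coeff 3 ≠ 0 := by
  have hD : pD i ≤ 3 := by rcases i with a | a <;> simp [pD]
  have hmon : (pG v i * X ^ (3 - pD i)).Monic := (pG_monic v i).mul (monic_X_pow _)
  have hdeg : (pG v i * X ^ (3 - pD i)).natDegree = 3 := by
    rw [(pG_monic v i).natDegree_mul (monic_X_pow _), pG_deg, natDegree_X_pow]; omega
  refine ⟨⟨pG v i * X ^ (3 - pD i), ?_⟩, ?_, ?_⟩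
  · rw [mem_degreeLT, ← natDegree_lt_iff_degree_lt hmon.ne_zero]; omega
  · rw [mem_flat]
    refine ⟨X ^ (3 - pD i), ?_, rfl⟩
    rw [degree_X_pow]
    exact_mod_cast (by omega : 3 - pD i < m)
  · have : (pG v i * X ^ (3 - pD i)).coeff 3 = 1 := by
      have h := hmon.coeff_natDegree
      rwa [hdeg] at h
    simp only [this]; exact one_ne_zero

theorem sum_subtype_le {α : Type} (A : Finset α) (P R : α → Prop) [DecidablePred P]
    [DecidablePred R] (h : ∀ a, P a → R a) :
    ∑ a : A, (if P a then 1 else 0) ≤ #(A.filter R) := by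
  rw [Finset.sum_coe_sort A (fun a => if P a then 1 else 0), ← Finset.card_filter]
  exact Finset.card_le_card (fun x hx => by simp at hx ⊢; exact ⟨hx.1, h _ hx.2⟩)

theorem deg_bound' (v : F) (hv : ∀ x : F, x ^ 2 + x + v ≠ 0) (A : Finset F) (B : Finset Fˣ)
    (f : F[X]) (hf : f ≠ 0) (DA : DecidablePred fun a => pG v (Sum.inl a) ∣ f)
    (DB : DecidablePred fun a => pG v (Sum.inr a) ∣ f) :
    #(A.filter fun a => pG v (Sum.inl a) ∣ f) + 2 * #(B.filter fun a => pG v (Sum.inr a) ∣ f)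
      ≤ f.natDegree := by
  have := deg_bound v hv ((A.filter fun a => pG v (Sum.inl a) ∣ f).disjSum
    (B.filter fun a => pG v (Sum.inr a) ∣ f)) f hf (by
      intro i hi
      rcases i with a | a
      · simp at hi; exact hi.2
      · simp at hi; exact hi.2)
  rw [Finset.sum_disjSum] at this
  simp [pD] at this
  omega

/-- the family of flats -/
noncomputable def fam (k : ℕ) (v : F) (A : Finset F) (B S : Finset Fˣ) :
    A ⊕ (B ⊕ S) → Submodule F (degreeLT F k)
  | Sum.inl a => flat k (pG v (Sum.inl a.1)) (k - 1)
  | Sum.inr (Sum.inl b) => flat k (pG v (Sum.inr b.1)) (k - 2)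
  | Sum.inr (Sum.inr b) => flat k (pG v (Sum.inr b.1)) 2

theorem fam_mult (k : ℕ) (hk : 6 ≤ k) (v : F) (hv : ∀ x : F, x ^ 2 + x + v ≠ 0)
    (A : Finset F) (hA : #A = 4) (B S : Finset Fˣ)
    (f : degreeLT F k) (hf : f ≠ 0) :
    ∑ j, (by classical exact if f ∈ fam k v A B S j then 1 else 0) ≤ k - 2 := by
  classical
  have hf' : (f : F[X]) ≠ 0 := by simpa using hf
  have hdeg : (f : F[X]).natDegree < k := by
    rw [natDegree_lt_iff_degree_lt hf']; exact mem_degreeLT.1 f.2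
  suffices key : ∑ a : A, (if f ∈ flat k (pG v (Sum.inl a.1)) (k - 1) then 1 else 0) +
      (∑ a : B, (if f ∈ flat k (pG v (Sum.inr a.1)) (k - 2) then 1 else 0) +
      ∑ a : S, (if f ∈ flat k (pG v (Sum.inr a.1)) 2 then 1 else 0)) ≤ k - 2 by
    rw [Fintype.sum_sum_type, Fintype.sum_sum_type]
    convert key <;> rfl
  have hdvd : ∀ i m, f ∈ flat k (pG v i) m → pG v i ∣ (f : F[X]) := by
    intro i m h
    obtain ⟨w, _, hw⟩ := mem_flat.1 h
    exact ⟨w, hw.symm⟩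
  have h1 := sum_subtype_le A (fun a => f ∈ flat k (pG v (Sum.inl a)) (k - 1))
    (fun a => pG v (Sum.inl a) ∣ (f : F[X])) (fun a => hdvd _ _)
  have h2 := sum_subtype_le B (fun a => f ∈ flat k (pG v (Sum.inr a)) (k - 2))
    (fun a => pG v (Sum.inr a) ∣ (f : F[X])) (fun a => hdvd _ _)
  have h3 := sum_subtype_le S (fun a => f ∈ flat k (pG v (Sum.inr a)) 2)
    (fun a => pG v (Sum.inr a) ∣ (f : F[X])) (fun a => hdvd _ _)
  have b1 := deg_bound' v hv A B f hf' inferInstance inferInstance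
  have b2 := deg_bound' v hv A S f hf' inferInstance inferInstance
  have b3 : #(A.filter fun a => pG v (Sum.inl a) ∣ (f : F[X])) ≤ 4 := by
    rw [← hA]; exact Finset.card_filter_le _ _
  by_cases hl : ∃ b : Fˣ, f ∈ flat k (pG v (Sum.inr b)) 2
  · obtain ⟨b, hb⟩ := hl
    obtain ⟨w, hw, hwf⟩ := mem_flat.1 hb
    have hw0 : w ≠ 0 := by
      rintro rfl
      exact hf' (by rw [← hwf, mul_zero])
    have hw' := (natDegree_lt_iff_degree_lt hw0).2 hw
    have : (f : F[X]).natDegree ≤ 3 := by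
      rw [← hwf, (pG_monic v _).natDegree_mul' hw0, pG_deg]
      simp only [pD]; omega
    omega
  · push Not at hl
    have : ∑ a : S, (if f ∈ flat k (pG v (Sum.inr a.1)) 2 then 1 else 0) = 0 := by
      simp [hl]
    omega

end poly

theorem arith_n (k q s : ℕ) (hk : 6 ≤ k) (hq4 : 4 ≤ q) (hs2 : s ≤ q - 1) :
    (q - 1) * (3 * q ^ (k - 1) - 2 * q ^ (k - 2) + 1 + (k - 5) * ((q ^ k - 1) / (q - 1))
          - s * (q + 1)) + (4 * (q ^ (k - 1) - 1) + ((q - 2) * (q ^ (k - 2) - 1) +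
          s * (q ^ 2 - 1))) = (k - 2) * (q ^ k - 1) := by
  obtain ⟨j, rfl⟩ := Nat.exists_eq_add_of_le' hk
  obtain ⟨t, rfl⟩ := Nat.exists_eq_add_of_le' hq4
  have hdiv : (t + 4 - 1) ∣ (t + 4) ^ (j + 6) - 1 := Nat.sub_one_dvd_pow_sub_one _ _
  obtain ⟨θ, hθ⟩ := hdiv
  have e0 : t + 4 - 1 = t + 3 := rfl
  rw [hθ, Nat.mul_div_cancel_left _ (by omega)]
  have hQ : 1 ≤ (t + 4) ^ (j + 3) := Nat.one_le_pow _ _ (by omega)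
  have hsb : s * (t + 4 + 1) ≤ (t + 3) * (t + 5) := Nat.mul_le_mul_right _ hs2
  have e1 : j + 6 - 1 = j + 5 := rfl
  have e2 : j + 6 - 2 = j + 4 := rfl
  have e3 : j + 6 - 5 = j + 1 := rfl
  have e4 : t + 4 - 2 = t + 2 := rfl
  rw [e0] at hs2 hθ
  rw [e0, e1, e2, e3, e4, ← hθ]
  have p4 : (t + 4) ^ (j + 4) = (t + 4) ^ (j + 3) * (t + 4) := pow_succ _ _
  have p5 : (t + 4) ^ (j + 5) = (t + 4) ^ (j + 3) * (t + 4) ^ 2 := by ring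
  have p6 : (t + 4) ^ (j + 6) = (t + 4) ^ (j + 3) * (t + 4) ^ 3 := by ring
  rw [p6] at hθ
  rw [p4, p5, p6]
  generalize (t + 4) ^ (j + 3) = Q at *
  have c1 : 2 * (Q * (t + 4)) ≤ 3 * (Q * (t + 4) ^ 2) := by nlinarith [Nat.zero_le (Q * t), Nat.zero_le (Q * t ^ 2)]
  have c1' : 2 * (Q * (t + 4)) + (t + 4) ^ 2 ≤ 3 * (Q * (t + 4) ^ 2) := by
    have := Nat.mul_le_mul_right ((t + 4) ^ 2) hQ
    nlinarith [Nat.zero_le (Q * t), Nat.zero_le (Q * t ^ 2)]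
  have c2 : s * (t + 4 + 1) ≤ 3 * (Q * (t + 4) ^ 2) - 2 * (Q * (t + 4)) + 1 + (j + 1) * θ := by
    have : (t + 3) * (t + 5) ≤ (t + 4) ^ 2 := by nlinarith
    have := Nat.zero_le ((j + 1) * θ)
    omega
  have c3 : 1 ≤ Q * (t + 4) := Nat.mul_pos hQ (by omega)
  have c4 : 1 ≤ Q * (t + 4) ^ 2 := Nat.mul_pos hQ (by positivity)
  have c5 : 1 ≤ Q * (t + 4) ^ 3 := Nat.mul_pos hQ (by positivity)
  have c6 : 1 ≤ (t + 4) ^ 2 := Nat.one_le_pow _ _ (by omega)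
  zify [c1, c2, c3, c4, c5, c6] at hθ ⊢
  linear_combination (-(j : ℤ) - 1) * hθ

theorem arith_d (k q s : ℕ) (hk : 6 ≤ k) (hq4 : 4 ≤ q) (hs2 : s ≤ q - 1) :
    (q - 1) * ((k - 2) * q ^ (k - 1) - 5 * q ^ (k - 2) + 2 * q ^ (k - 3) - s * q) +
      (4 * (q ^ (k - 1) - q ^ (k - 1 - 1)) + ((q - 2) * (q ^ (k - 2) - q ^ (k - 2 - 1)) +
          s * (q ^ 2 - q ^ (2 - 1)))) = (k - 2) * (q ^ k - q ^ (k - 1)) ∧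
    0 < (k - 2) * q ^ (k - 1) - 5 * q ^ (k - 2) + 2 * q ^ (k - 3) - s * q := by
  obtain ⟨j, rfl⟩ := Nat.exists_eq_add_of_le' hk
  obtain ⟨t, rfl⟩ := Nat.exists_eq_add_of_le' hq4
  have hQ : 1 ≤ (t + 4) ^ (j + 2) := Nat.one_le_pow _ _ (by omega)
  have e0 : t + 4 - 1 = t + 3 := rfl
  have e1 : j + 6 - 1 = j + 5 := rfl
  have e2 : j + 6 - 2 = j + 4 := rfl
  have e3 : j + 6 - 3 = j + 3 := rfl
  have e4 : t + 4 - 2 = t + 2 := rfl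
  have e5 : j + 5 - 1 = j + 4 := rfl
  have e6 : j + 4 - 1 = j + 3 := rfl
  have e7 : 2 - 1 = 1 := rfl
  rw [e0] at hs2
  rw [e0, e1, e2, e3, e4, e5, e6, e7, pow_one]
  have hsb : s * (t + 4) ≤ (t + 3) * (t + 4) := Nat.mul_le_mul_right _ hs2
  have p3 : (t + 4) ^ (j + 3) = (t + 4) ^ (j + 2) * (t + 4) := pow_succ _ _
  have p4 : (t + 4) ^ (j + 4) = (t + 4) ^ (j + 2) * (t + 4) ^ 2 := by ring
  have p5 : (t + 4) ^ (j + 5) = (t + 4) ^ (j + 2) * (t + 4) ^ 3 := by ring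
  have p6 : (t + 4) ^ (j + 6) = (t + 4) ^ (j + 2) * (t + 4) ^ 4 := by ring
  rw [p3, p4, p5, p6]
  generalize (t + 4) ^ (j + 2) = Q at *
  have c0 : 5 * (Q * (t + 4) ^ 2) + Q * (t + 4) ^ 2 ≤ (j + 4) * (Q * (t + 4) ^ 3) := by
    have : 6 ≤ (j + 4) * (t + 4) := by nlinarith
    calc _ = 6 * (Q * (t + 4) ^ 2) := by ring
      _ ≤ ((j + 4) * (t + 4)) * (Q * (t + 4) ^ 2) := Nat.mul_le_mul_right _ this
      _ = _ := by ring
  have c1 : 5 * (Q * (t + 4) ^ 2) ≤ (j + 4) * (Q * (t + 4) ^ 3) := by omega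
  have c2 : (t + 3) * (t + 4) < Q * (t + 4) ^ 2 := by
    have := Nat.mul_le_mul_right ((t + 4) ^ 2) hQ
    nlinarith
  have c3 : s * (t + 4) < (j + 4) * (Q * (t + 4) ^ 3) - 5 * (Q * (t + 4) ^ 2) +
      2 * (Q * (t + 4)) := by omega
  have c4 : Q * (t + 4) ≤ Q * (t + 4) ^ 2 :=
    Nat.mul_le_mul_left _ (Nat.le_self_pow (by norm_num) _)
  have c5 : Q * (t + 4) ^ 2 ≤ Q * (t + 4) ^ 3 :=
    Nat.mul_le_mul_left _ (Nat.pow_le_pow_right (by omega) (by norm_num))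
  have c6 : Q * (t + 4) ^ 3 ≤ Q * (t + 4) ^ 4 :=
    Nat.mul_le_mul_left _ (Nat.pow_le_pow_right (by omega) (by norm_num))
  have c7 : t + 4 ≤ (t + 4) ^ 2 := Nat.le_self_pow (by norm_num) _
  refine ⟨?_, by omega⟩
  have c3' := c3.le
  zify [c1, c3', c4, c5, c6, c7]
  ring

/-- For every integer `k ≥ 6`, every prime power `q ≥ k - 2` and every `s` with
`1 ≤ s ≤ q - 1`, there exists a
`[3q^{k-1} - 2q^{k-2} + 1 + (k-5)θ_{k-1} - s(q+1), k,
(k-2)q^{k-1} - 5q^{k-2} + 2q^{k-3} - sq]_q` code, where `θ_{k-1} = (q^k - 1)/(q - 1)`. -/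
theorem statement11 (k q s : ℕ) (hk : 6 ≤ k) (hq : IsPrimePow q) (hkq : k - 2 ≤ q)
    (hs1 : 1 ≤ s) (hs2 : s ≤ q - 1)
    (F : Type) [Field F] [Fintype F] [DecidableEq F] (hF : Fintype.card F = q) :
    ∃ C : Submodule F
        (Fin (3 * q ^ (k - 1) - 2 * q ^ (k - 2) + 1 + (k - 5) * ((q ^ k - 1) / (q - 1))
          - s * (q + 1)) → F),
      IsLinearCodeWith F
        (3 * q ^ (k - 1) - 2 * q ^ (k - 2) + 1 + (k - 5) * ((q ^ k - 1) / (q - 1))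
          - s * (q + 1)) k
        ((k - 2) * q ^ (k - 1) - 5 * q ^ (k - 2) + 2 * q ^ (k - 3) - s * q) C := by
  classical
  have hq4 : 4 ≤ q := by omega
  obtain ⟨v, hv⟩ := exists_noroot (F := F)
  have hu : Fintype.card Fˣ = q - 1 := by rw [Fintype.card_units, hF]
  obtain ⟨A, -, hA⟩ := Finset.exists_subset_card_eq (s := (Finset.univ : Finset F)) (n := 4)
    (by rw [Finset.card_univ, hF]; exact hq4)
  obtain ⟨B, -, hB⟩ := Finset.exists_subset_card_eq (s := (Finset.univ : Finset Fˣ)) (n := q - 2)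
    (by rw [Finset.card_univ, hu]; omega)
  obtain ⟨S, -, hS⟩ := Finset.exists_subset_card_eq (s := (Finset.univ : Finset Fˣ)) (n := s)
    (by rw [Finset.card_univ, hu]; omega)
  have : Fintype (degreeLT F k) := Fintype.ofEquiv _ (degreeLTEquiv F k).symm.toEquiv
  have r1 : ∀ a : A, Module.finrank F (fam k v A B S (Sum.inl a)) = k - 1 := fun a =>
    finrank_flat _ _ _ (pG_monic v _) (by rw [pG_deg]; simp only [pD]; omega)
  have r2 : ∀ a : B, Module.finrank F (fam k v A B S (Sum.inr (Sum.inl a))) = k - 2 := fun a =>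
    finrank_flat _ _ _ (pG_monic v _) (by rw [pG_deg]; simp only [pD]; omega)
  have r3 : ∀ a : S, Module.finrank F (fam k v A B S (Sum.inr (Sum.inr a))) = 2 := fun a =>
    finrank_flat _ _ _ (pG_monic v _) (by rw [pG_deg]; simp only [pD]; omega)
  let φ : Module.Dual F (degreeLT F k) := (lcoeff F 3).comp (degreeLT F k).subtype
  have hwit : ∀ j, ∃ u ∈ fam k v A B S j, φ u ≠ 0 := by
    intro j
    rcases j with a | b | b
    · exact flat_wit k (by omega) v (Sum.inl a.1) (k - 1) (by simp only [pD]; omega)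
    · exact flat_wit k (by omega) v (Sum.inr b.1) (k - 2) (by simp only [pD]; omega)
    · exact flat_wit k (by omega) v (Sum.inr b.1) 2 (by simp only [pD]; omega)
  refine code_exists (fam k v A B S) (k - 2) _ k _ (finrank_degLT k)
    (fun f hf => fam_mult k hk v hv A hA B S f hf) ?_ ?_ (arith_d k q s hk hq4 hs2).2 φ hwit ?_
  · rw [Fintype.sum_sum_type, Fintype.sum_sum_type]
    simp only [r1, r2, r3, Finset.sum_const, Finset.card_univ, Fintype.card_coe, hA, hB, hS,
      smul_eq_mul, hF]
    exact arith_n k q s hk hq4 hs2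
  · rw [Fintype.sum_sum_type, Fintype.sum_sum_type]
    simp only [r1, r2, r3, Finset.sum_const, Finset.card_univ, Fintype.card_coe, hA, hB, hS,
      smul_eq_mul, hF]
    exact (arith_d k q s hk hq4 hs2).1
  · intro h0
    obtain ⟨u, _, hu⟩ := flat_wit k (by omega) v (Sum.inl (0 : F)) (k - 1)
      (by simp only [pD]; omega)
    exact hu (LinearMap.congr_fun h0 u)
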